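/- Cancellation lemma: Σ c_{λ*B} · a_{λ+ρ+ω(B^u)}(x|y) = 0, where the sum is over all reverse barred tableaux B of shape μ such that the unbarred column word of λ*B is NOT Yamanouchi. -/

import Mathlib

open scoped Classical
open MvPolynomial

noncomputable section

namespace EqLR

/-- Ambient polynomial ring `ℂ[x_1,…,x_d ; y_i (i ∈ ℤ)]`.
The variables `x_j` are indexed by `Fin d` (so `x_{j+1} = X (Sum.inl j)`), and the
variables `y_i` are indexed by `ℤ` (only positive indices actually occur). -/
abbrev P (d : ℕ) := MvPolynomial (Fin d ⊕ ℤ) ℂ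

/-- The variable `y_i`. -/
def yI (d : ℕ) (i : ℤ) : P d := X (Sum.inr i)

/-- The variable `x_v` for a value `v ∈ {1,…,d}` (junk value `0` otherwise). -/
def xv (d : ℕ) (v : ℕ) : P d :=
  if h : v - 1 < d then X (Sum.inl ⟨v - 1, h⟩) else 0

/-- The component `ξ_v` of a vector `ξ ∈ ℕ^d`, for a (1-based) value `v ∈ {1,…,d}`. -/
def vecAt {d : ℕ} (ξ : Fin d → ℕ) (v : ℕ) : ℕ :=
  if h : v - 1 < d then ξ ⟨v - 1, h⟩ else 0

/-- `μ ∈ ℕ^d` is a partition:  `μ_1 ≥ μ_2 ≥ … ≥ μ_d`. -/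
def IsPartitionVec {d : ℕ} (μ : Fin d → ℕ) : Prop :=
  ∀ i j : Fin d, i ≤ j → μ j ≤ μ i

/-- `|μ| = μ_1 + ⋯ + μ_d`. -/
def wt {d : ℕ} (μ : Fin d → ℕ) : ℕ := ∑ i, μ i

/-- `ρ = (d-1, d-2, …, 0)`. -/
def rho (d : ℕ) : Fin d → ℕ := fun i => d - 1 - (i : ℕ)

/-- Cells `(r, c)` (both 0-based) of the Young/reverse Young diagram whose row `r` has
length `μ_{r+1}`.  For the reverse diagram, rows are numbered bottom-to-top and columns
right-to-left; for the ordinary Young diagram, top-to-bottom and left-to-right. -/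
def cells (d : ℕ) (μ : Fin d → ℕ) : Finset (ℕ × ℕ) :=
  (Finset.range d ×ˢ Finset.range (Finset.univ.sup μ + 1)).filter
    fun rc => ∃ h : rc.1 < d, rc.2 < μ ⟨rc.1, h⟩

/-- In the column reading word of a *reverse* diagram (columns right-to-left, i.e. in
increasing 0-based column index, each column read top-to-bottom, i.e. in decreasing
0-based row index), the cell `b` is read strictly before the cell `a`. -/
def revBefore (a b : ℕ × ℕ) : Prop := b.2 < a.2 ∨ (b.2 = a.2 ∧ a.1 < b.1)

/-- In the column reading word of an ordinary Young diagram (rightmost column first,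
each column read top-to-bottom), the cell `b` is read strictly before the cell `a`. -/
def youngBefore (a b : ℕ × ℕ) : Prop := a.2 < b.2 ∨ (b.2 = a.2 ∧ b.1 < a.1)

/-- A reverse tableau of shape `μ`: entries in `{1,…,d}`, weakly increasing along rows
(left to right) and strictly increasing down columns (top to bottom). -/
structure RevTableau (d : ℕ) (μ : Fin d → ℕ) where
  val : ℕ × ℕ → ℕ
  mem : ∀ a ∈ cells d μ, 1 ≤ val a ∧ val a ≤ d
  zero : ∀ a ∉ cells d μ, val a = 0
  row : ∀ r c : ℕ, (r, c + 1) ∈ cells d μ → val (r, c + 1) ≤ val (r, c)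
  col : ∀ r c : ℕ, (r + 1, c) ∈ cells d μ → val (r + 1, c) < val (r, c)

/-- The factor `x_v - y_{(d+1-v) + c(a) - r(a)}` attached to an entry of value `v` in
the cell `a` of the reverse diagram (`c(a) = a.2 + 1`, `r(a) = a.1 + 1`, 1-based). -/
def factor (d : ℕ) (v : ℕ) (a : ℕ × ℕ) : P d :=
  xv d v - yI d ((d : ℤ) + 1 - (v : ℤ) + (a.2 : ℤ) - (a.1 : ℤ))

/-- The factorial Schur function `s_μ(x|y) = Σ_R (x|y)^R`. -/
def fSchur (d : ℕ) (μ : Fin d → ℕ) : P d :=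
  ∑ᶠ R : RevTableau d μ, ∏ a ∈ cells d μ, factor d (R.val a) a

/-- The ordinary Schur function `s_μ(x) = Σ_R x^R`. -/
def schurX (d : ℕ) (μ : Fin d → ℕ) : P d :=
  ∑ᶠ R : RevTableau d μ, ∏ a ∈ cells d μ, xv d (R.val a)

/-- The subalgebra `ℂ[y]` of polynomials in the `y` variables only. -/
def ySub (d : ℕ) : Subalgebra ℂ (P d) :=
  Algebra.adjoin ℂ (Set.range fun i : ℤ => yI d i)

/-- `p` is symmetric in the `x` variables. -/
def SymmX {d : ℕ} (p : P d) : Prop :=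
  ∀ σ : Equiv.Perm (Fin d), rename (⇑(Equiv.sumCongr σ (Equiv.refl ℤ))) p = p

/-- The falling factorial power `(x_j | y)^k = (x_j - y_1)⋯(x_j - y_k)`. -/
def ffPow (d : ℕ) (j : Fin d) (k : ℕ) : P d :=
  ∏ i ∈ Finset.range k, (X (Sum.inl j) - yI d ((i : ℤ) + 1))

/-- `(x|y)^ξ = (x_1|y)^{ξ_1} ⋯ (x_d|y)^{ξ_d}`. -/
def xyPow (d : ℕ) (ξ : Fin d → ℕ) : P d := ∏ j : Fin d, ffPow d j (ξ j)

/-- The alternant `a_ξ(x|y) = det[(x_j|y)^{ξ_i}]`. -/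
def aDet (d : ℕ) (ξ : Fin d → ℕ) : P d :=
  Matrix.det (Matrix.of fun i j : Fin d => ffPow d j (ξ i))

/-! ### Skew barred tableaux of shape `λ*μ` -/

/-- A skew barred tableau of shape `λ*μ`: the Young diagram `λ` (placed above and to
the right of the reverse diagram `μ`) is filled with values in `{1,…,d}` (field `top`),
the reverse diagram `μ` is filled with values in `{1,…,d}` (field `bot`), some of whose
cells may be barred (field `barred`); values weakly increase along rows left-to-right
and strictly increase down columns, ignoring bars. -/
structure SkewBarredTableau (d : ℕ) (lam mu : Fin d → ℕ) where
  top : ℕ × ℕ → ℕ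
  bot : ℕ × ℕ → ℕ
  barred : ℕ × ℕ → Prop
  top_mem : ∀ a ∈ cells d lam, 1 ≤ top a ∧ top a ≤ d
  top_zero : ∀ a ∉ cells d lam, top a = 0
  bot_mem : ∀ a ∈ cells d mu, 1 ≤ bot a ∧ bot a ≤ d
  bot_zero : ∀ a ∉ cells d mu, bot a = 0
  barred_sub : ∀ a, barred a → a ∈ cells d mu
  top_row : ∀ r c : ℕ, (r, c + 1) ∈ cells d lam → top (r, c) ≤ top (r, c + 1)
  top_col : ∀ r c : ℕ, (r + 1, c) ∈ cells d lam → top (r, c) < top (r + 1, c)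
  bot_row : ∀ r c : ℕ, (r, c + 1) ∈ cells d mu → bot (r, c + 1) ≤ bot (r, c)
  bot_col : ∀ r c : ℕ, (r + 1, c) ∈ cells d mu → bot (r + 1, c) < bot (r, c)

namespace SkewBarredTableau

variable {d : ℕ} {lam mu : Fin d → ℕ}

/-- `ω(L^u_{<a})_k`: the number of `k`'s among the unbarred entries of `L` read strictly
before the `μ`-cell `a` in the unbarred column word (all of `λ` is read before `μ`). -/
def countBefore (L : SkewBarredTableau d lam mu) (a : ℕ × ℕ) (k : ℕ) : ℕ :=
  ((cells d lam).filter fun b => L.top b = k).card +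
  ((cells d mu).filter fun b => ¬ L.barred b ∧ L.bot b = k ∧ revBefore a b).card

/-- `ω(L^u_{≤a})_k`: as `countBefore`, but the entry of `a` itself is also counted when
`a` is unbarred. -/
def countUpTo (L : SkewBarredTableau d lam mu) (a : ℕ × ℕ) (k : ℕ) : ℕ :=
  ((cells d lam).filter fun b => L.top b = k).card +
  ((cells d mu).filter fun b => ¬ L.barred b ∧ L.bot b = k ∧ (revBefore a b ∨ b = a)).card

/-- Prefix content within the `λ`-part of the word. -/
def topCountUpTo (L : SkewBarredTableau d lam mu) (a : ℕ × ℕ) (k : ℕ) : ℕ :=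
  ((cells d lam).filter fun b => L.top b = k ∧ (youngBefore a b ∨ b = a)).card

/-- `ω(L^u)_k`: total content of the unbarred column word of `L`. -/
def content (L : SkewBarredTableau d lam mu) (k : ℕ) : ℕ :=
  ((cells d lam).filter fun b => L.top b = k).card +
  ((cells d mu).filter fun b => ¬ L.barred b ∧ L.bot b = k).card

/-- The unbarred column word of `L` is Yamanouchi: every prefix contains at least as
many `k`'s as `(k+1)`'s, for every `k ≥ 1`. -/
def Yamanouchi (L : SkewBarredTableau d lam mu) : Prop :=
  (∀ a ∈ cells d lam, ∀ k : ℕ, 1 ≤ k → L.topCountUpTo a (k + 1) ≤ L.topCountUpTo a k) ∧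
  (∀ a ∈ cells d mu, ¬ L.barred a → ∀ k : ℕ, 1 ≤ k →
      L.countUpTo a (k + 1) ≤ L.countUpTo a k)

/-- `L` is an equivariant Littlewood–Richardson skew tableau of shape `λ*μ` and unbarred
content `ν`. -/
def IsLR (L : SkewBarredTableau d lam mu) (ν : Fin d → ℕ) : Prop :=
  L.Yamanouchi ∧ ∀ i : Fin d, L.content ((i : ℕ) + 1) = ν i

/-- The index `|a|' + ω(L^u_{<a})_{|a|}` of the first `y` in the factor of `c_L` at a
barred cell `a`. -/
def eIdx (L : SkewBarredTableau d lam mu) (a : ℕ × ℕ) : ℤ :=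
  ((d : ℤ) + 1 - (L.bot a : ℤ)) + (L.countBefore a (L.bot a) : ℤ)

/-- The index `|a|' + c(a) - r(a)` of the second `y` in the factor of `c_L` at a barred
cell `a`. -/
def fIdx (L : SkewBarredTableau d lam mu) (a : ℕ × ℕ) : ℤ :=
  ((d : ℤ) + 1 - (L.bot a : ℤ)) + (a.2 : ℤ) - (a.1 : ℤ)

/-- The weight `c_L = ∏_{a barred} (y_{|a|'+ω(L^u_{<a})_{|a|}} - y_{|a|'+c(a)-r(a)})`. -/
def cWt (L : SkewBarredTableau d lam mu) : P d :=
  ∏ a ∈ (cells d mu).filter (fun a => L.barred a), (yI d (L.eIdx a) - yI d (L.fIdx a))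

/-- `Δ(a) = ω(L^u_{≤a})_{|a|} - c(a) + r(a)`. -/
def Δ (L : SkewBarredTableau d lam mu) (a : ℕ × ℕ) : ℤ :=
  (L.countUpTo a (L.bot a) : ℤ) - ((a.2 : ℤ) + 1) + ((a.1 : ℤ) + 1)

end SkewBarredTableau

/-! ### Reverse barred tableaux -/

/-- A reverse barred tableau of shape `μ`. -/
structure RevBarredTableau (d : ℕ) (μ : Fin d → ℕ) where
  val : ℕ × ℕ → ℕ
  barred : ℕ × ℕ → Prop
  mem : ∀ a ∈ cells d μ, 1 ≤ val a ∧ val a ≤ d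
  zero : ∀ a ∉ cells d μ, val a = 0
  barred_sub : ∀ a, barred a → a ∈ cells d μ
  row : ∀ r c : ℕ, (r, c + 1) ∈ cells d μ → val (r, c + 1) ≤ val (r, c)
  col : ∀ r c : ℕ, (r + 1, c) ∈ cells d μ → val (r + 1, c) < val (r, c)

namespace RevBarredTableau

variable {d : ℕ} {μ : Fin d → ℕ}

/-- `ω(B^u_{<a})_k`. -/
def countBefore (B : RevBarredTableau d μ) (a : ℕ × ℕ) (k : ℕ) : ℕ :=
  ((cells d μ).filter fun b => ¬ B.barred b ∧ B.val b = k ∧ revBefore a b).card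

/-- `ω(B^u_{≤a})_k` (including `a` itself when unbarred). -/
def countUpTo (B : RevBarredTableau d μ) (a : ℕ × ℕ) (k : ℕ) : ℕ :=
  ((cells d μ).filter fun b => ¬ B.barred b ∧ B.val b = k ∧ (revBefore a b ∨ b = a)).card

/-- `ω(B^u)_k`. -/
def content (B : RevBarredTableau d μ) (k : ℕ) : ℕ :=
  ((cells d μ).filter fun b => ¬ B.barred b ∧ B.val b = k).card

/-- `e_{ξ,B}(a) = (ξ + ω(B^u_{<a}))_{|a|}`. -/
def eIdx (B : RevBarredTableau d μ) (ξ : Fin d → ℕ) (a : ℕ × ℕ) : ℤ :=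
  (vecAt ξ (B.val a) : ℤ) + (B.countBefore a (B.val a) : ℤ)

/-- `f_B(a) = |a|' + c(a) - r(a)`. -/
def fIdx (B : RevBarredTableau d μ) (a : ℕ × ℕ) : ℤ :=
  ((d : ℤ) + 1 - (B.val a : ℤ)) + (a.2 : ℤ) - (a.1 : ℤ)

/-- `c_{ξ,B} = ∏_{a barred} (y_{e_{ξ,B}(a)} - y_{f_B(a)})`. -/
def cXi (B : RevBarredTableau d μ) (ξ : Fin d → ℕ) : P d :=
  ∏ a ∈ (cells d μ).filter (fun a => B.barred a), (yI d (B.eIdx ξ a) - yI d (B.fIdx a))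

/-- The unbarred column word of `λ*B` is Yamanouchi (the `λ`-part is the canonical
filling of `λ`, whose whole content `λ` is added to every prefix of `B^u`). -/
def StarYam (B : RevBarredTableau d μ) (lam : Fin d → ℕ) : Prop :=
  ∀ a ∈ cells d μ, ¬ B.barred a → ∀ k : ℕ, 1 ≤ k →
    vecAt lam (k + 1) + B.countUpTo a (k + 1) ≤ vecAt lam k + B.countUpTo a k

end RevBarredTableau

/-! ### Reverse hatted tableaux -/

/-- A hat decoration: none, left hat, or right hat. -/
inductive Hat where
  | unhatted : Hat
  | left : Hat
  | right : Hat
deriving DecidableEq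

/-- A reverse hatted tableau of shape `μ`. -/
structure RevHattedTableau (d : ℕ) (μ : Fin d → ℕ) where
  val : ℕ × ℕ → ℕ
  hat : ℕ × ℕ → Hat
  mem : ∀ a ∈ cells d μ, 1 ≤ val a ∧ val a ≤ d
  zero : ∀ a ∉ cells d μ, val a = 0
  hat_out : ∀ a ∉ cells d μ, hat a = Hat.unhatted
  row : ∀ r c : ℕ, (r, c + 1) ∈ cells d μ → val (r, c + 1) ≤ val (r, c)
  col : ∀ r c : ℕ, (r + 1, c) ∈ cells d μ → val (r + 1, c) < val (r, c)

namespace RevHattedTableau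

variable {d : ℕ} {μ : Fin d → ℕ}

/-- `ω(H^u_{<a})_k`: content of the unhatted column word of `H` read before `a`. -/
def countBefore (H : RevHattedTableau d μ) (a : ℕ × ℕ) (k : ℕ) : ℕ :=
  ((cells d μ).filter fun b => H.hat b = Hat.unhatted ∧ H.val b = k ∧ revBefore a b).card

/-- `ω(H^u)_k`. -/
def content (H : RevHattedTableau d μ) (k : ℕ) : ℕ :=
  ((cells d μ).filter fun b => H.hat b = Hat.unhatted ∧ H.val b = k).card

/-- `e_{ξ,H}(a) = (ξ + ω(H^u_{<a}))_{|a|}`. -/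
def eIdx (H : RevHattedTableau d μ) (ξ : Fin d → ℕ) (a : ℕ × ℕ) : ℤ :=
  (vecAt ξ (H.val a) : ℤ) + (H.countBefore a (H.val a) : ℤ)

/-- `f_H(a) = |a|' + c(a) - r(a)`. -/
def fIdx (H : RevHattedTableau d μ) (a : ℕ × ℕ) : ℤ :=
  ((d : ℤ) + 1 - (H.val a : ℤ)) + (a.2 : ℤ) - (a.1 : ℤ)

/-- `d_{ξ,H} = ∏_{a ∈ H^l} y_{e_{ξ,H}(a)} · ∏_{a ∈ H^r} (-y_{f_H(a)})`. -/
def dWt (H : RevHattedTableau d μ) (ξ : Fin d → ℕ) : P d :=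
  (∏ a ∈ (cells d μ).filter (fun a => H.hat a = Hat.left), yI d (H.eIdx ξ a)) *
  ∏ a ∈ (cells d μ).filter (fun a => H.hat a = Hat.right), (-(yI d (H.fIdx a)))

end RevHattedTableau

/-- `H̄ = B`: `H` unbars to the reverse barred tableau `B`. -/
def UnbarsTo {d : ℕ} {μ : Fin d → ℕ} (H : RevHattedTableau d μ)
    (B : RevBarredTableau d μ) : Prop :=
  H.val = B.val ∧ ∀ a, (H.hat a ≠ Hat.unhatted ↔ B.barred a)

/-- The simple transposition `σ_i` on values: exchanges `i` and `i+1`. -/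
def swapVal (i v : ℕ) : ℕ := if v = i then i + 1 else if v = i + 1 then i else v

/-- The action of `σ_i` on `ℕ^d` by permuting coordinates. -/
def swapVec {d : ℕ} (i : ℕ) (ξ : Fin d → ℕ) : Fin d → ℕ :=
  fun j => vecAt ξ (swapVal i ((j : ℕ) + 1))

/-! ### Reverse (barred) subtableaux -/

/-- A reverse subtableau of shape `μ`: each cell is empty (value `0`) or carries a value
in `{1,…,d}`; no row or column conditions. -/
structure RevSubTableau (d : ℕ) (μ : Fin d → ℕ) where
  val : ℕ × ℕ → ℕ
  mem : ∀ a ∈ cells d μ, val a ≤ d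
  zero : ∀ a ∉ cells d μ, val a = 0

/-- A reverse barred subtableau of shape `μ`: a reverse subtableau some of whose filled
cells are barred. -/
structure RevBarredSubTableau (d : ℕ) (μ : Fin d → ℕ) where
  val : ℕ × ℕ → ℕ
  barred : ℕ × ℕ → Prop
  mem : ∀ a ∈ cells d μ, val a ≤ d
  zero : ∀ a ∉ cells d μ, val a = 0
  barred_filled : ∀ a, barred a → a ∈ cells d μ ∧ val a ≠ 0

/-- `(x|y)^R` for a reverse subtableau `R`. -/
def RevSubTableau.xyProd {d : ℕ} {μ : Fin d → ℕ} (R : RevSubTableau d μ) : P d :=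
  ∏ a ∈ (cells d μ).filter (fun a => R.val a ≠ 0), factor d (R.val a) a

namespace RevBarredSubTableau

variable {d : ℕ} {μ : Fin d → ℕ}

/-- `ω(B^u_{<a})_k`: unbarred filled entries of value `k` read before `a`. -/
def countBefore (B : RevBarredSubTableau d μ) (a : ℕ × ℕ) (k : ℕ) : ℕ :=
  ((cells d μ).filter fun b => ¬ B.barred b ∧ B.val b = k ∧ revBefore a b).card

/-- `ω(B^u)_k`. -/
def content (B : RevBarredSubTableau d μ) (k : ℕ) : ℕ :=
  ((cells d μ).filter fun b => ¬ B.barred b ∧ B.val b = k).card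

/-- `e_{ξ,B}(a) = (ξ + ω(B^u_{<a}))_{|a|}`. -/
def eIdx (B : RevBarredSubTableau d μ) (ξ : Fin d → ℕ) (a : ℕ × ℕ) : ℤ :=
  (vecAt ξ (B.val a) : ℤ) + (B.countBefore a (B.val a) : ℤ)

/-- `f_B(a) = |a|' + c(a) - r(a)`. -/
def fIdx (B : RevBarredSubTableau d μ) (a : ℕ × ℕ) : ℤ :=
  ((d : ℤ) + 1 - (B.val a : ℤ)) + (a.2 : ℤ) - (a.1 : ℤ)

/-- `c_{ξ,B}`. -/
def cXi (B : RevBarredSubTableau d μ) (ξ : Fin d → ℕ) : P d :=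
  ∏ a ∈ (cells d μ).filter (fun a => B.barred a), (yI d (B.eIdx ξ a) - yI d (B.fIdx a))

end RevBarredSubTableau

end EqLR

namespace EqLR

/-! ### Columns and the column-by-column generating function -/

/-- `C` is a strictly increasing column of height `h`, listed from bottom to top. -/
def IsCol (d h : ℕ) (C : ℕ → ℕ) : Prop :=
  (∀ r < h, 1 ≤ C r ∧ C r ≤ d) ∧ (∀ r, h ≤ r → C r = 0) ∧ ∀ r, r + 1 < h → C (r + 1) < C r

theorem IsCol.lt {d h : ℕ} {C : ℕ → ℕ} (hC : IsCol d h C) {r r' : ℕ} (hr : r < r')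
    (hr' : r' < h) : C r' < C r := by
  induction r', hr using Nat.le_induction with
  | base => exact hC.2.2 r hr'
  | succ n hn ih => exact (hC.2.2 n hr').trans (ih (by omega))

theorem IsCol.eq_of_eq {d h : ℕ} {C : ℕ → ℕ} (hC : IsCol d h C) {r r' : ℕ} (hr : r < h)
    (hr' : r' < h) (e : C r = C r') : r = r' := by
  rcases lt_trichotomy r r' with hlt | heq | hlt
  · exact absurd (hC.lt hlt hr') (by omega)
  · exact heq
  · exact absurd (hC.lt hlt hr) (by omega)

theorem IsCol.lt_of_pos {d h : ℕ} {C : ℕ → ℕ} (hC : IsCol d h C) {r : ℕ} (hr : 1 ≤ C r) :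
    r < h := by
  by_contra hn
  have := hC.2.1 r (by omega)
  omega

theorem finite_isCol (d h : ℕ) : {D : ℕ → ℕ | IsCol d h D}.Finite := by
  have hb : ∀ (D : {D : ℕ → ℕ | IsCol d h D}) (r : Fin h), D.1 r < d + 1 := fun D r =>
    Nat.lt_succ_of_le (D.2.1 r r.2).2
  have hf : Finite {D : ℕ → ℕ | IsCol d h D} := by
    refine Finite.of_injective (β := Fin h → Fin (d + 1)) (fun D r => ⟨D.1 r, hb D r⟩) ?_
    intro D E hDE
    refine Subtype.ext (funext fun r => ?_)
    by_cases hr : r < h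
    · simpa using congrFun hDE ⟨r, hr⟩
    · rw [D.2.2.1 r (not_lt.mp hr), E.2.2.1 r (not_lt.mp hr)]
  exact hf

/-- The columns of height `h` that may be placed immediately to the left of `C`. -/
def colSet (d h : ℕ) (C : ℕ → ℕ) : Finset (ℕ → ℕ) :=
  ((finite_isCol d h).subset (t := {D | IsCol d h D ∧ ∀ r < h, D r ≤ C r})
    fun _ hD => hD.1).toFinset

theorem mem_colSet {d h : ℕ} {C D : ℕ → ℕ} :
    D ∈ colSet d h C ↔ IsCol d h D ∧ ∀ r < h, D r ≤ C r := by
  simp [colSet]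

/-- The product of the factors of a column `D` of height `h` placed at column index `c`. -/
def colProd (d h c : ℕ) (D : ℕ → ℕ) : P d := ∏ r ∈ Finset.range h, factor d (D r) (r, c)

/-- The sum of `(x|y)^R` over all fillings `R` of the `m` columns with indices
`c, …, c + m - 1` and heights `H`, placed immediately to the left of the column `C`. -/
def fillSum (d : ℕ) (H : ℕ → ℕ) : ℕ → ℕ → (ℕ → ℕ) → P d
  | 0, _, _ => 1
  | m + 1, c, C => ∑ D ∈ colSet d (H c) C, colProd d (H c) c D * fillSum d H m (c + 1) D

/-! ### Symmetry of the generating function -/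

/-- The ring endomorphism `s` exchanges `x_k` and `x_{k+1}` and fixes the other variables. -/
structure IsSwap (d k : ℕ) (s : P d →+* P d) : Prop where
  left : s (xv d k) = xv d (k + 1)
  right : s (xv d (k + 1)) = xv d k
  other : ∀ v, 1 ≤ v → v ≤ d → v ≠ k → v ≠ k + 1 → s (xv d v) = xv d v
  y : ∀ i, s (yI d i) = yI d i

theorem IsSwap.factor_other {d k : ℕ} {s : P d →+* P d} (hs : IsSwap d k s) {v : ℕ}
    (h1 : 1 ≤ v) (h2 : v ≤ d) (h3 : v ≠ k) (h4 : v ≠ k + 1) (a : ℕ × ℕ) :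
    s (factor d v a) = factor d v a := by
  simp [factor, hs.other v h1 h2 h3 h4, hs.y]

/-- Two vertically adjacent entries `k`, `k + 1` contribute a symmetric product, and so do
two horizontally adjacent factors `k`, `k + 1`. -/
theorem IsSwap.factor_mul {d k : ℕ} {s : P d →+* P d} (hs : IsSwap d k s) {a b : ℕ × ℕ}
    (h : (a.2 : ℤ) - a.1 + 1 = b.2 - b.1) :
    s (factor d k a * factor d (k + 1) b) = factor d k a * factor d (k + 1) b := by
  have e : (d : ℤ) + 1 - ((k + 1 : ℕ) : ℤ) + b.2 - b.1 = (d : ℤ) + 1 - (k : ℤ) + a.2 - a.1 := by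
    push_cast; linarith
  simp only [factor, e, map_mul, map_sub, hs.left, hs.right, hs.y]
  ring

theorem IsSwap.factor_add {d k : ℕ} {s : P d →+* P d} (hs : IsSwap d k s) (a b : ℕ × ℕ) :
    s (factor d k a + factor d (k + 1) b) = factor d k a + factor d (k + 1) b := by
  simp only [factor, map_add, map_sub, hs.left, hs.right, hs.y]
  ring

/-- Exchange `k` and `k + 1` in a column, unless it contains both. -/
def flipCol (k : ℕ) (D : ℕ → ℕ) : ℕ → ℕ :=
  if (∃ r, D r = k) ∧ ∃ r, D r = k + 1 then D else fun r => swapVal k (D r)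

theorem swapVal_swapVal (k v : ℕ) : swapVal k (swapVal k v) = v := by
  unfold swapVal; split_ifs <;> omega

theorem swapVal_eq_left {k v : ℕ} : swapVal k v = k ↔ v = k + 1 := by
  unfold swapVal; split_ifs <;> omega

theorem swapVal_eq_right {k v : ℕ} : swapVal k v = k + 1 ↔ v = k := by
  unfold swapVal; split_ifs <;> omega

theorem flipCol_flipCol (k : ℕ) (D : ℕ → ℕ) : flipCol k (flipCol k D) = D := by
  by_cases h : (∃ r, D r = k) ∧ ∃ r, D r = k + 1
  · simp only [flipCol, if_pos h]
  · have h' : ¬ ((∃ r, swapVal k (D r) = k) ∧ ∃ r, swapVal k (D r) = k + 1) := by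
      simp only [swapVal_eq_left, swapVal_eq_right]
      exact fun h'' => h ⟨h''.2, h''.1⟩
    simp only [flipCol, if_neg h, if_neg h', swapVal_swapVal]

theorem IsCol.flipCol {d h k : ℕ} {D : ℕ → ℕ} (hD : IsCol d h D) (hk : 1 ≤ k)
    (hkd : k + 1 ≤ d) : IsCol d h (flipCol k D) := by
  by_cases hb : (∃ r, D r = k) ∧ ∃ r, D r = k + 1
  · rwa [EqLR.flipCol, if_pos hb]
  · rw [EqLR.flipCol, if_neg hb]
    refine ⟨fun r hr => ?_, fun r hr => ?_, fun r hr => ?_⟩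
    · have := hD.1 r hr
      simp only [swapVal]; split_ifs <;> omega
    · have := hD.2.1 r hr
      simp only [swapVal]; split_ifs <;> omega
    · have h1 := hD.2.2 r hr
      have h2 : ¬ (D (r + 1) = k ∧ D r = k + 1) := fun h => hb ⟨⟨_, h.1⟩, ⟨_, h.2⟩⟩
      simp only [swapVal]; split_ifs <;> omega

theorem flipCol_mem_colSet {d h h' k : ℕ} {C D : ℕ → ℕ} (hk : 1 ≤ k) (hkd : k + 1 ≤ d)
    (hC : IsCol d h' C) (hCk : (∃ r, C r = k + 1) ∨ ∀ r, C r ≠ k)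
    (hD : D ∈ colSet d h C) : flipCol k D ∈ colSet d h C := by
  rw [mem_colSet] at hD ⊢
  refine ⟨hD.1.flipCol hk hkd, fun r hr => ?_⟩
  have hDr := hD.2 r hr
  by_cases hb : (∃ r, D r = k) ∧ ∃ r, D r = k + 1
  · rwa [flipCol, if_pos hb]
  · rw [flipCol, if_neg hb]
    have key : D r = k → C r ≠ k := by
      intro hDk hCr
      obtain ⟨r₁, hr₁⟩ := hCk.resolve_right fun h => h r hCr
      have hr₁h : r₁ < h' := hC.lt_of_pos (by omega)
      have hlt : r₁ < r := by
        by_contra hn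
        rcases (not_lt.mp hn).eq_or_lt with e | hl
        · rw [← e] at hr₁; omega
        · have := hC.lt hl hr₁h; omega
      have h1 := hD.1.lt hlt hr
      have h2 := hD.2 r₁ (by omega)
      exact hb ⟨⟨r, hDk⟩, ⟨r₁, by omega⟩⟩
    unfold swapVal; split_ifs <;> omega

theorem colProd_eq_mul_erase (d c : ℕ) {h r : ℕ} (D : ℕ → ℕ) (hr : r < h) :
    colProd d h c D =
      factor d (D r) (r, c) * ∏ q ∈ (Finset.range h).erase r, factor d (D q) (q, c) :=
  (Finset.mul_prod_erase _ _ (Finset.mem_range.mpr hr)).symm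

theorem IsSwap.prod_factor {d k h c : ℕ} {s : P d →+* P d} (hs : IsSwap d k s) {D : ℕ → ℕ}
    (hD : IsCol d h D) {t : Finset ℕ} (ht : ∀ r ∈ t, r < h ∧ D r ≠ k ∧ D r ≠ k + 1) :
    s (∏ r ∈ t, factor d (D r) (r, c)) = ∏ r ∈ t, factor d (D r) (r, c) := by
  rw [map_prod]
  refine Finset.prod_congr rfl fun r hr => ?_
  obtain ⟨h1, h2, h3⟩ := ht r hr
  exact hs.factor_other (hD.1 r h1).1 (hD.1 r h1).2 h2 h3 _

theorem IsSwap.colProd_of_both {d k h c : ℕ} {s : P d →+* P d} (hs : IsSwap d k s)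
    (hk : 1 ≤ k) {D : ℕ → ℕ} (hD : IsCol d h D) {p q : ℕ} (hp : D p = k) (hq : D q = k + 1) :
    s (colProd d h c D) = colProd d h c D := by
  have hph : p < h := hD.lt_of_pos (by omega)
  have hqh : q < h := hD.lt_of_pos (by omega)
  have hpq : p = q + 1 := by
    rcases lt_trichotomy p (q + 1) with hl | he | hl
    · rcases (Nat.lt_succ_iff.mp hl).eq_or_lt with e | hl'
      · rw [e] at hp; omega
      · have := hD.lt hl' hqh; omega
    · exact he
    · have h1 := hD.lt hl hph
      have h2 := hD.2.2 q (by omega)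
      omega
  have hmem : q ∈ (Finset.range h).erase p := by
    simp only [Finset.mem_erase, Finset.mem_range]; omega
  rw [colProd_eq_mul_erase d c D hph, ← Finset.mul_prod_erase _ _ hmem, ← mul_assoc, hp, hq,
    map_mul, hs.factor_mul (by subst hpq; push_cast; ring), hs.prod_factor hD]
  intro r hr
  simp only [Finset.mem_erase, Finset.mem_range] at hr
  refine ⟨hr.2.2, fun e => hr.2.1 ?_, fun e => hr.1 ?_⟩
  · exact hD.eq_of_eq hr.2.2 hph (e.trans hp.symm)
  · exact hD.eq_of_eq hr.2.2 hqh (e.trans hq.symm)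

/-- The symmetry properties of a function `g` of columns of height `h` at column index `c`
that propagate from one column to the next one on its right. -/
def ColSymm (d k h c : ℕ) (s : P d →+* P d) (g : (ℕ → ℕ) → P d) : Prop :=
  (∀ C, IsCol d h C → ((∃ r, C r = k + 1) ∨ ∀ r, C r ≠ k) → s (g C) = g C) ∧
  ∀ C r, IsCol d h C → C r = k → (∀ q, C q ≠ k + 1) →
    s (factor d k (r, c) * g C + factor d (k + 1) (r, c) * g (flipCol k C)) =
      factor d k (r, c) * g C + factor d (k + 1) (r, c) * g (flipCol k C)

theorem flipCol_eq_update {d h k r : ℕ} {C : ℕ → ℕ} (hC : IsCol d h C) (hk : 1 ≤ k)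
    (hr : C r = k) (hC' : ∀ q, C q ≠ k + 1) : flipCol k C = Function.update C r (k + 1) := by
  funext q
  rw [flipCol, if_neg (fun h => h.2.elim hC')]
  rcases eq_or_ne q r with rfl | hne
  · simp [swapVal, hr]
  · have : C q ≠ k := fun e =>
      hne (hC.eq_of_eq (hC.lt_of_pos (by omega)) (hC.lt_of_pos (by omega)) (e.trans hr.symm))
    simp [swapVal, hne, this, hC' q]

theorem ColSymm.pair_of_left {d k h c : ℕ} {s : P d →+* P d} {g : (ℕ → ℕ) → P d}
    (hs : IsSwap d k s) (hk : 1 ≤ k) (hg : ColSymm d k h c s g) {D : ℕ → ℕ} (hD : IsCol d h D)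
    {r : ℕ} (hr : D r = k) (hD' : ∀ q, D q ≠ k + 1) :
    s (colProd d h c D * g D + colProd d h c (flipCol k D) * g (flipCol k D)) =
      colProd d h c D * g D + colProd d h c (flipCol k D) * g (flipCol k D) := by
  have hrh : r < h := hD.lt_of_pos (by omega)
  have hE := hg.2 D r hD hr hD'
  have hup := flipCol_eq_update hD hk hr hD'
  have hprod : ∏ q ∈ (Finset.range h).erase r, factor d (flipCol k D q) (q, c) =
      ∏ q ∈ (Finset.range h).erase r, factor d (D q) (q, c) := by
    refine Finset.prod_congr rfl fun q hq => ?_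
    rw [hup, Function.update_of_ne (Finset.ne_of_mem_erase hq)]
  have hw : s (∏ q ∈ (Finset.range h).erase r, factor d (D q) (q, c)) =
      ∏ q ∈ (Finset.range h).erase r, factor d (D q) (q, c) := by
    refine hs.prod_factor hD fun q hq => ?_
    simp only [Finset.mem_erase, Finset.mem_range] at hq
    exact ⟨hq.2, fun e => hq.1 (hD.eq_of_eq hq.2 hrh (e.trans hr.symm)), hD' q⟩
  have hval : flipCol k D r = k + 1 := by rw [hup, Function.update_self]
  rw [colProd_eq_mul_erase d c D hrh, colProd_eq_mul_erase d c _ hrh, hprod, hr, hval]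
  generalize ∏ q ∈ (Finset.range h).erase r, factor d (D q) (q, c) = w at hw ⊢
  have e : factor d k (r, c) * w * g D + factor d (k + 1) (r, c) * w * g (flipCol k D) =
      w * (factor d k (r, c) * g D + factor d (k + 1) (r, c) * g (flipCol k D)) := by ring
  rw [e, map_mul, hw, hE]

theorem ColSymm.pair {d k h c : ℕ} {s : P d →+* P d} {g : (ℕ → ℕ) → P d}
    (hs : IsSwap d k s) (hk : 1 ≤ k) (hkd : k + 1 ≤ d) (hg : ColSymm d k h c s g)
    {D : ℕ → ℕ} (hD : IsCol d h D) :
    s (colProd d h c D * g D + colProd d h c (flipCol k D) * g (flipCol k D)) =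
      colProd d h c D * g D + colProd d h c (flipCol k D) * g (flipCol k D) := by
  by_cases h1 : ∃ r, D r = k
  · obtain ⟨r, hr⟩ := h1
    by_cases h2 : ∃ r, D r = k + 1
    · obtain ⟨q, hq⟩ := h2
      have hf : flipCol k D = D := if_pos ⟨⟨r, hr⟩, ⟨q, hq⟩⟩
      rw [hf, map_add, map_mul, hs.colProd_of_both hk hD hr hq, hg.1 D hD (Or.inl ⟨q, hq⟩)]
    · exact hg.pair_of_left hs hk hD hr (not_exists.mp h2)
  · have hf : flipCol k D = fun r => swapVal k (D r) := if_neg fun h => h1 h.1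
    by_cases h2 : ∃ r, D r = k + 1
    · obtain ⟨q, hq⟩ := h2
      have := hg.pair_of_left hs hk (hD.flipCol hk hkd) (r := q)
        (by rw [hf]; exact swapVal_eq_left.mpr hq)
        (fun r => by rw [hf]; exact fun e => h1 ⟨r, swapVal_eq_right.mp e⟩)
      rw [flipCol_flipCol] at this
      rwa [add_comm]
    · have h1' := not_exists.mp h1
      have h2' := not_exists.mp h2
      have hf' : flipCol k D = D := by
        rw [hf]; funext r; simp [swapVal, h1' r, h2' r]
      rw [hf', map_add, map_mul, hg.1 D hD (Or.inr h1'), colProd,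
        hs.prod_factor hD fun r hr => ⟨Finset.mem_range.mp hr, h1' r, h2' r⟩]

theorem ColSymm.sum_colSet {d k h h' c : ℕ} {s : P d →+* P d} {g : (ℕ → ℕ) → P d}
    (hs : IsSwap d k s) (hk : 1 ≤ k) (hkd : k + 1 ≤ d) (hg : ColSymm d k h c s g)
    {C : ℕ → ℕ} (hC : IsCol d h' C)
    (hCk : (∃ r, C r = k + 1) ∨ ∀ r, C r ≠ k) :
    s (∑ D ∈ colSet d h C, colProd d h c D * g D) =
      ∑ D ∈ colSet d h C, colProd d h c D * g D := by
  have hflip : ∑ D ∈ colSet d h C, colProd d h c (flipCol k D) * g (flipCol k D) =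
      ∑ D ∈ colSet d h C, colProd d h c D * g D :=
    Finset.sum_nbij' (flipCol k) (flipCol k)
      (fun D hD => flipCol_mem_colSet hk hkd hC hCk hD)
      (fun D hD => flipCol_mem_colSet hk hkd hC hCk hD)
      (fun D _ => flipCol_flipCol k D) (fun D _ => flipCol_flipCol k D) (fun D _ => rfl)
  have h2 : (2 : P d) * ∑ D ∈ colSet d h C, colProd d h c D * g D =
      ∑ D ∈ colSet d h C,
        (colProd d h c D * g D + colProd d h c (flipCol k D) * g (flipCol k D)) := by
    rw [Finset.sum_add_distrib, hflip, two_mul]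
  have h3 : s ((2 : P d) * ∑ D ∈ colSet d h C, colProd d h c D * g D) =
      2 * ∑ D ∈ colSet d h C, colProd d h c D * g D := by
    rw [h2, map_sum]
    exact Finset.sum_congr rfl fun D hD => hg.pair hs hk hkd (mem_colSet.mp hD).1
  rw [map_mul, map_ofNat] at h3
  exact mul_left_cancel₀ two_ne_zero h3

theorem colSet_filter_flipCol {d k h h' r : ℕ} {C : ℕ → ℕ} (hk : 1 ≤ k) (hC : IsCol d h' C)
    (hr : C r = k) (hC' : ∀ q, C q ≠ k + 1) :
    (colSet d h (flipCol k C)).filter (fun D => ¬ D r = k + 1) = colSet d h C := by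
  have hup := flipCol_eq_update hC hk hr hC'
  ext D
  simp only [Finset.mem_filter, mem_colSet, hup]
  constructor
  · rintro ⟨⟨h1, h2⟩, h3⟩
    refine ⟨h1, fun q hq => ?_⟩
    have := h2 q hq
    rcases eq_or_ne q r with rfl | hne
    · rw [Function.update_self] at this; omega
    · rwa [Function.update_of_ne hne] at this
  · rintro ⟨h1, h2⟩
    refine ⟨⟨h1, fun q hq => ?_⟩, fun e => ?_⟩
    · have := h2 q hq
      rcases eq_or_ne q r with rfl | hne
      · rw [Function.update_self]; omega
      · rwa [Function.update_of_ne hne]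
    · have := h2 r (h1.lt_of_pos (by omega))
      omega

theorem ColSymm.step {d k h h' c : ℕ} {s : P d →+* P d} {g : (ℕ → ℕ) → P d}
    (hs : IsSwap d k s) (hk : 1 ≤ k) (hkd : k + 1 ≤ d) (hg : ColSymm d k h (c + 1) s g) :
    ColSymm d k h' c s (fun C => ∑ D ∈ colSet d h C, colProd d h (c + 1) D * g D) := by
  refine ⟨fun C hC hCk => hg.sum_colSet hs hk hkd hC hCk, fun C r hC hr hC' => ?_⟩
  have hup := flipCol_eq_update hC hk hr hC'
  have hval : flipCol k C r = k + 1 := by rw [hup, Function.update_self]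
  have hQ := hg.sum_colSet hs hk hkd  (hC.flipCol hk hkd) (Or.inl ⟨r, hval⟩)
  have hsplit := Finset.sum_filter_add_sum_filter_not (colSet d h (flipCol k C))
    (fun D => D r = k + 1) (fun D => colProd d h (c + 1) D * g D)
  rw [colSet_filter_flipCol hk hC hr hC'] at hsplit
  have hT : s (factor d k (r, c) * ∑ D ∈ colSet d h (flipCol k C) with D r = k + 1,
        colProd d h (c + 1) D * g D) =
      factor d k (r, c) * ∑ D ∈ colSet d h (flipCol k C) with D r = k + 1,
        colProd d h (c + 1) D * g D := by
    rw [Finset.mul_sum, map_sum]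
    refine Finset.sum_congr rfl fun D hD => ?_
    rw [Finset.mem_filter, mem_colSet] at hD
    obtain ⟨⟨hD, hDC⟩, hDr⟩ := hD
    have hrh : r < h := hD.lt_of_pos (by omega)
    have hw : s (∏ q ∈ (Finset.range h).erase r, factor d (D q) (q, c + 1)) =
        ∏ q ∈ (Finset.range h).erase r, factor d (D q) (q, c + 1) := by
      refine hs.prod_factor hD fun q hq => ?_
      simp only [Finset.mem_erase, Finset.mem_range] at hq
      refine ⟨hq.2, fun e => ?_, fun e => hq.1 (hD.eq_of_eq hq.2 hrh (e.trans hDr.symm))⟩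
      have hqr : r < q := by
        by_contra hn
        have := hD.lt (lt_of_le_of_ne (not_lt.mp hn) hq.1) hrh
        omega
      have h1 := hDC q hq.2
      rw [hup, Function.update_of_ne hq.1] at h1
      have h2 := hC.lt hqr (hC.lt_of_pos (by omega))
      omega
    rw [colProd_eq_mul_erase d (c + 1) D hrh, hDr]
    simp only [← mul_assoc]
    rw [map_mul, map_mul, hs.factor_mul (by push_cast; ring), hw,
      hg.1 D hD (Or.inl ⟨r, hDr⟩)]
  have e : factor d k (r, c) * ∑ D ∈ colSet d h C, colProd d h (c + 1) D * g D +
      factor d (k + 1) (r, c) * ∑ D ∈ colSet d h (flipCol k C), colProd d h (c + 1) D * g D =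
      (factor d k (r, c) + factor d (k + 1) (r, c)) *
        ∑ D ∈ colSet d h (flipCol k C), colProd d h (c + 1) D * g D -
      factor d k (r, c) * ∑ D ∈ colSet d h (flipCol k C) with D r = k + 1,
        colProd d h (c + 1) D * g D := by
    rw [← hsplit]; ring
  simp only
  rw [e, map_sub, map_mul, hs.factor_add, hQ, hT]

theorem colSymm_fillSum {d k : ℕ} {s : P d →+* P d} (hs : IsSwap d k s) (hk : 1 ≤ k)
    (hkd : k + 1 ≤ d) (H : ℕ → ℕ) (m c : ℕ) :
    ColSymm d k (H c) c s (fillSum d H m (c + 1)) := by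
  induction m generalizing c with
  | zero =>
    refine ⟨fun C _ _ => map_one s, fun C r _ _ _ => ?_⟩
    simp only [fillSum, mul_one]
    exact hs.factor_add _ _
  | succ m ih => exact (ih (c + 1)).step hs hk hkd

/-! ### Alternation in the `x` variables -/

/-- The alternating sum of a polynomial over all permutations of the `x` variables. -/
def alt (d : ℕ) (p : P d) : P d :=
  ∑ σ : Equiv.Perm (Fin d), Equiv.Perm.sign σ • rename (Sum.map σ id) p

theorem alt_sum {ι : Type*} (d : ℕ) (t : Finset ι) (f : ι → P d) :
    alt d (∑ i ∈ t, f i) = ∑ i ∈ t, alt d (f i) := by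
  simp only [alt, map_sum, Finset.smul_sum]
  exact Finset.sum_comm

theorem alt_mul {d : ℕ} {q : P d}
    (hq : ∀ σ : Equiv.Perm (Fin d), rename (Sum.map σ id) q = q) (p : P d) :
    alt d (q * p) = q * alt d p := by
  simp only [alt, map_mul, hq, Finset.mul_sum, mul_smul_comm]

theorem alt_eq_zero {d : ℕ} {p : P d} {a b : Fin d} (hab : a ≠ b)
    (hp : rename (Sum.map (Equiv.swap a b) id) p = p) : alt d p = 0 := by
  have h : alt d p = -alt d p := by
    conv_lhs => rw [alt, ← Equiv.sum_comp (Equiv.mulRight (Equiv.swap a b))]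
    rw [alt, ← Finset.sum_neg_distrib]
    refine Finset.sum_congr rfl fun σ _ => ?_
    have e : (Sum.map (σ * Equiv.swap a b : Equiv.Perm (Fin d)) id : Fin d ⊕ ℤ → Fin d ⊕ ℤ) =
        Sum.map σ id ∘ Sum.map (Equiv.swap a b) id := by
      rw [Sum.map_comp_map]; rfl
    simp only [Equiv.coe_mulRight]
    rw [e, ← rename_rename, hp, Equiv.Perm.sign_mul,
      Equiv.Perm.sign_swap hab, mul_neg_one, Units.neg_smul]
  have h2 : (2 : P d) * alt d p = 0 := by
    rw [two_mul]; nth_rewrite 1 [h]; exact neg_add_cancel _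
  exact (mul_eq_zero.mp h2).resolve_left two_ne_zero

theorem rename_yI {d : ℕ} (σ : Equiv.Perm (Fin d)) (i : ℤ) :
    rename (Sum.map σ id) (yI d i) = yI d i := by
  simp [yI]

theorem rename_ffPow {d : ℕ} (σ : Equiv.Perm (Fin d)) (j : Fin d) (n : ℕ) :
    rename (Sum.map σ id) (ffPow d j n) = ffPow d (σ j) n := by
  simp [ffPow, map_prod, rename_yI]

theorem aDet_eq_alt (d : ℕ) (ξ : Fin d → ℕ) : aDet d ξ = alt d (xyPow d ξ) := by
  rw [aDet, ← Matrix.det_transpose, Matrix.det_apply, alt]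
  refine Finset.sum_congr rfl fun σ _ => ?_
  simp [xyPow, map_prod, rename_ffPow]

theorem rename_swap_xyPow {d : ℕ} {ξ : Fin d → ℕ} {a b : Fin d} (h : ξ a = ξ b) :
    rename (Sum.map (Equiv.swap a b) id) (xyPow d ξ) = xyPow d ξ := by
  simp only [xyPow, map_prod, rename_ffPow]
  rw [← Equiv.prod_comp (Equiv.swap a b) (fun j => ffPow d j (ξ j))]
  refine Finset.prod_congr rfl fun j _ => ?_
  congr 1
  rw [Equiv.swap_apply_def]
  split_ifs with h1 h2
  · rw [h1, h]
  · rw [h2, h]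
  · rfl

theorem xv_eq {d v : ℕ} (hv : v - 1 < d) : xv d v = X (Sum.inl ⟨v - 1, hv⟩) := dif_pos hv

theorem isSwap_rename {d k : ℕ} (hk : 1 ≤ k) (hkd : k + 1 ≤ d) :
    IsSwap d k (rename (Sum.map
      (Equiv.swap (⟨k - 1, by omega⟩ : Fin d) ⟨k, by omega⟩) id) :
        P d →ₐ[ℂ] P d).toRingHom where
  left := by
    simp [xv_eq (show k - 1 < d by omega), xv_eq (show k + 1 - 1 < d by omega)]
  right := by
    simp [xv_eq (show k - 1 < d by omega), xv_eq (show k + 1 - 1 < d by omega)]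
  other v h1 h2 h3 h4 := by
    have : Equiv.swap (⟨k - 1, by omega⟩ : Fin d) ⟨k, by omega⟩ ⟨v - 1, by omega⟩ =
        ⟨v - 1, by omega⟩ :=
      Equiv.swap_apply_of_ne_of_ne (by simp only [ne_eq, Fin.mk.injEq]; omega)
        (by simp only [ne_eq, Fin.mk.injEq]; omega)
    simp [xv_eq (show v - 1 < d by omega), this]
  y i := rename_yI _ i

/-! ### Expansion of a column into barred columns -/

theorem vecAt_eq {d v : ℕ} (ξ : Fin d → ℕ) (hv : v - 1 < d) : vecAt ξ v = ξ ⟨v - 1, hv⟩ :=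
  dif_pos hv

theorem ffPow_succ (d : ℕ) (j : Fin d) (n : ℕ) :
    ffPow d j (n + 1) = ffPow d j n * (X (Sum.inl j) - yI d ((n : ℤ) + 1)) :=
  Finset.prod_range_succ _ _

theorem xyPow_update (d : ℕ) (ξ : Fin d → ℕ) (j : Fin d) :
    xyPow d (Function.update ξ j (ξ j + 1)) =
      xyPow d ξ * (X (Sum.inl j) - yI d ((ξ j : ℤ) + 1)) := by
  rw [xyPow, xyPow, ← Finset.mul_prod_erase _ _ (Finset.mem_univ j),
    ← Finset.mul_prod_erase _ (fun i => ffPow d i (ξ i)) (Finset.mem_univ j),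
    Function.update_self, ffPow_succ]
  have : ∏ i ∈ Finset.univ.erase j, ffPow d i (Function.update ξ j (ξ j + 1) i) =
      ∏ i ∈ Finset.univ.erase j, ffPow d i (ξ i) :=
    Finset.prod_congr rfl fun i hi => by rw [Function.update_of_ne (Finset.ne_of_mem_erase hi)]
  rw [this]; ring

theorem xyPow_add_card {d h : ℕ} {D : ℕ → ℕ} (hD : IsCol d h D) (ξ : Fin d → ℕ)
    (U : Finset ℕ) (hU : U ⊆ Finset.range h) :
    xyPow d (fun i => ξ i + (U.filter fun r => D r = (i : ℕ) + 1).card) =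
      xyPow d ξ * ∏ r ∈ U, (xv d (D r) - yI d ((vecAt ξ (D r) : ℤ) + 1)) := by
  induction U using Finset.induction_on with
  | empty => simp
  | insert r U hr ih =>
    have hrh : r < h := Finset.mem_range.mp (hU (Finset.mem_insert_self r U))
    have hDr := hD.1 r hrh
    have hlt : D r - 1 < d := by omega
    have hU' : U ⊆ Finset.range h := (Finset.subset_insert r U).trans hU
    have h0 : (U.filter fun q => D q = D r - 1 + 1) = ∅ := by
      refine Finset.filter_eq_empty_iff.mpr fun q hq e => hr ?_
      rwa [← hD.eq_of_eq (Finset.mem_range.mp (hU' hq)) hrh (by omega)]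
    have e : (fun i : Fin d => ξ i + ((insert r U).filter fun q => D q = (i : ℕ) + 1).card) =
        Function.update (fun i : Fin d => ξ i + (U.filter fun q => D q = (i : ℕ) + 1).card)
          ⟨D r - 1, hlt⟩ (ξ ⟨D r - 1, hlt⟩ +
            (U.filter fun q => D q = D r - 1 + 1).card + 1) := by
      funext i
      rcases eq_or_ne i ⟨D r - 1, hlt⟩ with rfl | hne
      · rw [Function.update_self, Finset.filter_insert, if_pos (by simp only; omega),
          Finset.card_insert_of_notMem (by simp [hr]), add_assoc]
      · have : D r ≠ (i : ℕ) + 1 := fun e => hne (Fin.ext (by simp only; omega))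
        rw [Function.update_of_ne hne, Finset.filter_insert, if_neg this]
    rw [e, xyPow_update, ih hU', Finset.prod_insert hr, h0, xv_eq hlt, vecAt_eq ξ hlt]
    simp only [Finset.card_empty, add_zero]
    ring

/-- The weight of the barred cells `S` of a column `D` at column index `c`. -/
def barWt (d c : ℕ) (ξ : Fin d → ℕ) (D : ℕ → ℕ) (S : Finset ℕ) : P d :=
  ∏ r ∈ S, (yI d ((vecAt ξ (D r) : ℤ) + 1) - yI d ((d : ℤ) + 1 - (D r : ℤ) + c - r))

theorem rename_barWt {d : ℕ} (c : ℕ) (ξ : Fin d → ℕ) (D : ℕ → ℕ) (S : Finset ℕ)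
    (σ : Equiv.Perm (Fin d)) :
    rename (Sum.map σ id) (barWt d c ξ D S) = barWt d c ξ D S := by
  simp [barWt, map_prod, rename_yI]

theorem xyPow_mul_colProd {d h : ℕ} {D : ℕ → ℕ} (hD : IsCol d h D) (c : ℕ) (ξ : Fin d → ℕ) :
    xyPow d ξ * colProd d h c D = ∑ S ∈ (Finset.range h).powerset, barWt d c ξ D S *
      xyPow d (fun i => ξ i + ((Finset.range h \ S).filter fun r => D r = (i : ℕ) + 1).card) := by
  have e : colProd d h c D = ∏ r ∈ Finset.range h,
      ((yI d ((vecAt ξ (D r) : ℤ) + 1) - yI d ((d : ℤ) + 1 - (D r : ℤ) + c - r)) +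
        (xv d (D r) - yI d ((vecAt ξ (D r) : ℤ) + 1))) := by
    refine Finset.prod_congr rfl fun r _ => ?_
    rw [factor]; ring
  rw [e, Finset.prod_add, Finset.mul_sum]
  refine Finset.sum_congr rfl fun S _ => ?_
  rw [xyPow_add_card hD ξ _ Finset.sdiff_subset, barWt]
  ring

theorem alt_xyPow_mul_fillSum (d : ℕ) (H : ℕ → ℕ) (m c : ℕ) (C : ℕ → ℕ) (ξ : Fin d → ℕ) :
    alt d (xyPow d ξ * fillSum d H (m + 1) c C) =
      ∑ D ∈ colSet d (H c) C, ∑ S ∈ (Finset.range (H c)).powerset,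
        barWt d c ξ D S * alt d (xyPow d (fun i => ξ i +
          ((Finset.range (H c) \ S).filter fun r => D r = (i : ℕ) + 1).card) *
            fillSum d H m (c + 1) D) := by
  rw [fillSum, Finset.mul_sum, alt_sum]
  refine Finset.sum_congr rfl fun D hD => ?_
  rw [← mul_assoc, xyPow_mul_colProd (mem_colSet.mp hD).1, Finset.sum_mul, alt_sum]
  refine Finset.sum_congr rfl fun S _ => ?_
  rw [mul_assoc, alt_mul (rename_barWt c ξ D S)]

theorem alt_xyPow_mul_fillSum_eq_zero {d k : ℕ} (hk : 1 ≤ k) (hkd : k + 1 ≤ d) (H : ℕ → ℕ)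
    (m c : ℕ) {C : ℕ → ℕ} (hC : IsCol d (H c) C) {r : ℕ} (hr : C r = k + 1) {ξ : Fin d → ℕ}
    (hξ : ξ ⟨k - 1, by omega⟩ = ξ ⟨k, by omega⟩) :
    alt d (xyPow d ξ * fillSum d H m (c + 1) C) = 0 := by
  refine alt_eq_zero (a := ⟨k - 1, by omega⟩) (b := ⟨k, by omega⟩)
    (by simp only [ne_eq, Fin.mk.injEq]; omega) ?_
  rw [map_mul, rename_swap_xyPow hξ]
  congr 1
  exact (colSymm_fillSum (isSwap_rename hk hkd) hk hkd H m c).1 C hC (Or.inl ⟨r, hr⟩)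

/-! ### Reverse barred tableaux, column by column -/

theorem mem_cells {d : ℕ} {μ : Fin d → ℕ} {r c : ℕ} :
    (r, c) ∈ cells d μ ↔ ∃ h : r < d, c < μ ⟨r, h⟩ := by
  simp only [cells, Finset.mem_filter, Finset.mem_product, Finset.mem_range,
    and_iff_right_iff_imp]
  rintro ⟨h, hc⟩
  exact ⟨h, hc.trans_le (Nat.le_succ_of_le (Finset.le_sup (Finset.mem_univ _)))⟩

theorem exists_notMem_cells {d : ℕ} (μ : Fin d → ℕ) (c : ℕ) : ∃ r, (r, c) ∉ cells d μ :=
  ⟨d, fun h => (mem_cells.mp h).elim fun h _ => h.false⟩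

/-- The height of the column with index `c`. -/
def colHeight (d : ℕ) (μ : Fin d → ℕ) (c : ℕ) : ℕ := Nat.find (exists_notMem_cells μ c)

theorem mem_cells_iff {d : ℕ} {μ : Fin d → ℕ} (hμ : IsPartitionVec μ) {r c : ℕ} :
    (r, c) ∈ cells d μ ↔ r < colHeight d μ c := by
  constructor
  · intro h
    by_contra hn
    apply Nat.find_spec (exists_notMem_cells μ c)
    obtain ⟨hr, hc⟩ := mem_cells.mp h
    have hle : Nat.find (exists_notMem_cells μ c) ≤ r := not_lt.mp hn
    exact mem_cells.mpr ⟨hle.trans_lt hr, hc.trans_le (hμ _ _ hle)⟩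
  · intro h
    exact not_not.mp (Nat.find_min (exists_notMem_cells μ c) h)

theorem mem_cells_of_succ {d : ℕ} {μ : Fin d → ℕ} {r c : ℕ} (h : (r, c + 1) ∈ cells d μ) :
    (r, c) ∈ cells d μ := by
  rw [mem_cells] at h ⊢
  exact h.imp fun _ hc => by omega

instance (d : ℕ) (μ : Fin d → ℕ) : Finite (RevBarredTableau d μ) := by
  have hb : ∀ (B : RevBarredTableau d μ) (a : cells d μ), B.val a < d + 1 := fun B a =>
    Nat.lt_succ_of_le (B.mem a a.2).2
  refine Finite.of_injective (β := (cells d μ → Fin (d + 1)) × (cells d μ → Prop))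
    (fun B => (fun a => ⟨B.val a, hb B a⟩, fun a => B.barred a)) ?_
  intro B B' h
  obtain ⟨h1, h2⟩ := Prod.mk.inj h
  have e1 : B.val = B'.val := by
    funext a
    by_cases ha : a ∈ cells d μ
    · simpa using congrFun h1 ⟨a, ha⟩
    · rw [B.zero a ha, B'.zero a ha]
  have e2 : B.barred = B'.barred := by
    funext a
    by_cases ha : a ∈ cells d μ
    · exact congrFun h2 ⟨a, ha⟩
    · exact propext ⟨fun h => absurd (B.barred_sub a h) ha,
        fun h => absurd (B'.barred_sub a h) ha⟩
  cases B; cases B'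
  subst e1 e2
  rfl

instance (d : ℕ) (μ : Fin d → ℕ) : Fintype (RevBarredTableau d μ) := Fintype.ofFinite _

/-- The number of unbarred entries `k` in the columns with index less than `j`, for the
entries `v` and the bars `b`. -/
def colContent {d : ℕ} (μ : Fin d → ℕ) (v : ℕ × ℕ → ℕ) (b : ℕ × ℕ → Prop) (j k : ℕ) : ℕ :=
  ((cells d μ).filter fun a => ¬ b a ∧ v a = k ∧ a.2 < j).card

theorem colContent_zero {d : ℕ} (μ : Fin d → ℕ) (v : ℕ × ℕ → ℕ) (b : ℕ × ℕ → Prop) (k : ℕ) :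
    colContent μ v b 0 k = 0 := by
  simp [colContent]

theorem colContent_succ {d : ℕ} {μ : Fin d → ℕ} (hμ : IsPartitionVec μ) (v : ℕ × ℕ → ℕ)
    (b : ℕ × ℕ → Prop) (j k : ℕ) :
    colContent μ v b (j + 1) k = colContent μ v b j k +
      ((Finset.range (colHeight d μ j)).filter fun r => ¬ b (r, j) ∧ v (r, j) = k).card := by
  have hinj : Function.Injective fun r : ℕ => (r, j) := fun r r' h => (Prod.mk.inj h).1
  rw [← Finset.card_image_of_injective _ hinj, colContent, colContent,
    ← Finset.card_union_of_disjoint]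
  · congr 1
    ext ⟨r, c⟩
    simp only [Finset.mem_filter, Finset.mem_union, Finset.mem_image, Finset.mem_range,
      Prod.mk.injEq, ← mem_cells_iff hμ]
    constructor
    · rintro ⟨h1, h2, h3, h4⟩
      rcases Nat.lt_succ_iff_lt_or_eq.mp h4 with h | rfl
      · exact Or.inl ⟨h1, h2, h3, h⟩
      · exact Or.inr ⟨r, ⟨h1, h2, h3⟩, rfl, rfl⟩
    · rintro (⟨h1, h2, h3, h4⟩ | ⟨r, ⟨h1, h2, h3⟩, rfl, rfl⟩)
      · exact ⟨h1, h2, h3, by omega⟩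
      · exact ⟨h1, h2, h3, by omega⟩
  · rw [Finset.disjoint_left]
    rintro ⟨r, c⟩ h1 h2
    simp only [Finset.mem_filter, Finset.mem_image, Prod.mk.injEq] at h1 h2
    obtain ⟨_, _, _, rfl⟩ := h2
    exact absurd h1.2.2.2 (lt_irrefl _)

/-- The entries `v`, `v'` and the bars `b`, `b'` agree in the columns with index less
than `j`. -/
def Agree (j : ℕ) (v : ℕ × ℕ → ℕ) (b : ℕ × ℕ → Prop) (v' : ℕ × ℕ → ℕ) (b' : ℕ × ℕ → Prop) :
    Prop :=
  ∀ a : ℕ × ℕ, a.2 < j → v' a = v a ∧ (b' a ↔ b a)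

theorem Agree.colContent_eq {d : ℕ} {μ : Fin d → ℕ} {j i : ℕ} {v v' : ℕ × ℕ → ℕ}
    {b b' : ℕ × ℕ → Prop} (h : Agree j v b v' b') (hi : i ≤ j) (k : ℕ) :
    colContent μ v' b' i k = colContent μ v b i k := by
  unfold colContent
  congr 1
  refine Finset.filter_congr fun a _ => ?_
  constructor
  · rintro ⟨h1, h2, h3⟩
    have := h a (h3.trans_le hi)
    exact ⟨fun hb => h1 (this.2.mpr hb), this.1 ▸ h2, h3⟩
  · rintro ⟨h1, h2, h3⟩
    have := h a (h3.trans_le hi)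
    exact ⟨fun hb => h1 (this.2.mp hb), this.1.trans h2, h3⟩

/-- The barred cells of the column with index `c`. -/
def barSet (d : ℕ) (μ : Fin d → ℕ) (b : ℕ × ℕ → Prop) (c : ℕ) : Finset ℕ :=
  (Finset.range (colHeight d μ c)).filter fun r => b (r, c)

/-- The contribution of the column with index `c` to `c_{ζ+1,B}`. -/
def colWt {d : ℕ} (μ ζ : Fin d → ℕ) (v : ℕ × ℕ → ℕ) (b : ℕ × ℕ → Prop) (c : ℕ) : P d :=
  barWt d c (fun i => ζ i + colContent μ v b c ((i : ℕ) + 1)) (fun r => v (r, c))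
    (barSet d μ b c)

theorem Agree.colWt_eq {d : ℕ} {μ ζ : Fin d → ℕ} {j c : ℕ} {v v' : ℕ × ℕ → ℕ}
    {b b' : ℕ × ℕ → Prop} (h : Agree j v b v' b') (hc : c < j) :
    colWt μ ζ v' b' c = colWt μ ζ v b c := by
  unfold colWt
  have e1 : (fun r => v' (r, c)) = fun r => v (r, c) := funext fun r => (h (r, c) hc).1
  have e2 : barSet d μ b' c = barSet d μ b c := by
    unfold barSet
    exact Finset.filter_congr fun r _ => (h (r, c) hc).2
  have e3 : (fun i : Fin d => ζ i + colContent μ v' b' c ((i : ℕ) + 1)) =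
      fun i : Fin d => ζ i + colContent μ v b c ((i : ℕ) + 1) :=
    funext fun i => by rw [h.colContent_eq hc.le]
  rw [e1, e2, e3]

/-- The columns with index less than `j` form a reverse barred tableau. -/
structure IsPartialTableau {d : ℕ} (μ : Fin d → ℕ) (j : ℕ) (v : ℕ × ℕ → ℕ)
    (b : ℕ × ℕ → Prop) : Prop where
  isCol : ∀ c < j, IsCol d (colHeight d μ c) fun r => v (r, c)
  bar : ∀ c < j, ∀ r, b (r, c) → r < colHeight d μ c
  row : ∀ c, c + 1 < j → ∀ r < colHeight d μ (c + 1), v (r, c + 1) ≤ v (r, c)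

theorem RevBarredTableau.isPartialTableau {d : ℕ} {μ : Fin d → ℕ} (hμ : IsPartitionVec μ)
    (B : RevBarredTableau d μ) (j : ℕ) : IsPartialTableau μ j B.val B.barred where
  isCol c _ := ⟨fun r hr => B.mem _ ((mem_cells_iff hμ).mpr hr),
    fun r hr => B.zero _ fun h => absurd ((mem_cells_iff hμ).mp h) (by omega),
    fun r hr => B.col r c ((mem_cells_iff hμ).mpr hr)⟩
  bar c _ r hb := (mem_cells_iff hμ).mp (B.barred_sub _ hb)
  row c _ r hr := B.row r c ((mem_cells_iff hμ).mpr hr)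

/-- Replace the column with index `j` by `D`, with barred cells `S`. -/
theorem IsPartialTableau.extend {d : ℕ} {μ : Fin d → ℕ} {j : ℕ} {v : ℕ × ℕ → ℕ}
    {b : ℕ × ℕ → Prop} (h : IsPartialTableau μ (j + 1) v b) {D : ℕ → ℕ} {S : Finset ℕ}
    (hD : D ∈ colSet d (colHeight d μ (j + 1)) fun r => v (r, j))
    (hS : S ⊆ Finset.range (colHeight d μ (j + 1))) :
    IsPartialTableau μ (j + 1 + 1) (fun a => if a.2 = j + 1 then D a.1 else v a)
      (fun a => if a.2 = j + 1 then a.1 ∈ S else b a) where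
  isCol c hc := by
    by_cases e : c = j + 1
    · subst e; simpa using (mem_colSet.mp hD).1
    · simpa [e] using h.isCol c (by omega)
  bar c hc r hb := by
    by_cases e : c = j + 1
    · subst e
      simp only [if_true] at hb
      exact Finset.mem_range.mp (hS hb)
    · simp only [e, if_false] at hb
      exact h.bar c (by omega) r hb
  row c hc r hr := by
    by_cases e : c = j
    · subst e
      simpa using (mem_colSet.mp hD).2 r hr
    · have e' : c ≠ j + 1 := by omega
      simpa [e, e'] using h.row c (by omega) r hr

theorem exists_unique_of_agree {d : ℕ} {μ : Fin d → ℕ} (hμ : IsPartitionVec μ) {N : ℕ}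
    (hN : ∀ a ∈ cells d μ, a.2 < N) {v : ℕ × ℕ → ℕ} {b : ℕ × ℕ → Prop}
    (h : IsPartialTableau μ N v b) :
    ∃ B₀ : RevBarredTableau d μ,
      (Finset.univ.filter fun B : RevBarredTableau d μ => Agree N v b B.val B.barred) = {B₀} := by
  let B₀ : RevBarredTableau d μ :=
    { val := fun a => if a ∈ cells d μ then v a else 0
      barred := fun a => a ∈ cells d μ ∧ b a
      mem := fun a ha => by
        rw [if_pos ha]
        exact (h.isCol a.2 (hN a ha)).1 a.1 ((mem_cells_iff hμ).mp ha)
      zero := fun a ha => if_neg ha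
      barred_sub := fun a ha => ha.1
      row := fun r c hc => by
        rw [if_pos hc, if_pos (mem_cells_of_succ hc)]
        exact h.row c (hN _ hc) r ((mem_cells_iff hμ).mp hc)
      col := fun r c hc => by
        have hr := (mem_cells_iff hμ).mp hc
        rw [if_pos hc, if_pos ((mem_cells_iff hμ).mpr (by omega))]
        exact (h.isCol c (hN _ hc)).2.2 r hr }
  have hB₀ : Agree N v b B₀.val B₀.barred := by
    rintro ⟨r, c⟩ hc
    by_cases hm : (r, c) ∈ cells d μ
    · exact ⟨if_pos hm, fun hb => hb.2, fun hb => ⟨hm, hb⟩⟩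
    · have hr : ¬ r < colHeight d μ c := fun hr => hm ((mem_cells_iff hμ).mpr hr)
      exact ⟨(if_neg hm).trans ((h.isCol c hc).2.1 r (not_lt.mp hr)).symm, fun hb => hb.2,
        fun hb => absurd (h.bar c hc r hb) hr⟩
  refine ⟨B₀, Finset.eq_singleton_iff_unique_mem.mpr ⟨by simpa using hB₀, fun B hB => ?_⟩⟩
  have hB := (Finset.mem_filter.mp hB).2
  have e1 : B.val = B₀.val := by
    funext a
    by_cases ha : a ∈ cells d μ
    · rw [(hB a (hN a ha)).1, (hB₀ a (hN a ha)).1]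
    · rw [B.zero a ha, B₀.zero a ha]
  have e2 : B.barred = B₀.barred := by
    funext a
    by_cases ha : a ∈ cells d μ
    · exact propext ((hB a (hN a ha)).2.trans (hB₀ a (hN a ha)).2.symm)
    · exact propext ⟨fun h => absurd (B.barred_sub a h) ha,
        fun h => absurd (B₀.barred_sub a h) ha⟩
  clear_value B₀
  cases B; cases B₀
  subst e1 e2
  rfl

theorem sum_agree_eq_alt {d : ℕ} {μ : Fin d → ℕ} (hμ : IsPartitionVec μ) (ζ : Fin d → ℕ)
    {N : ℕ} (hN : ∀ a ∈ cells d μ, a.2 < N) (m j : ℕ) (hj : j + 1 + m = N)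
    {v : ℕ × ℕ → ℕ} {b : ℕ × ℕ → Prop} (h : IsPartialTableau μ (j + 1) v b) :
    ∑ B : RevBarredTableau d μ with Agree (j + 1) v b B.val B.barred,
        (∏ c ∈ Finset.Ico (j + 1) N, colWt μ ζ B.val B.barred c) *
          aDet d (fun i => ζ i + colContent μ B.val B.barred N ((i : ℕ) + 1)) =
      alt d (xyPow d (fun i => ζ i + colContent μ v b (j + 1) ((i : ℕ) + 1)) *
        fillSum d (colHeight d μ) m (j + 1) fun r => v (r, j)) := by
  induction m generalizing j v b with
  | zero =>
    obtain rfl : j + 1 = N := by omega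
    obtain ⟨B₀, hB₀⟩ := exists_unique_of_agree hμ hN h
    have hA : Agree (j + 1) v b B₀.val B₀.barred :=
      (Finset.mem_filter.mp (hB₀ ▸ Finset.mem_singleton_self B₀ :
        B₀ ∈ Finset.univ.filter fun B : RevBarredTableau d μ =>
          Agree (j + 1) v b B.val B.barred)).2
    rw [hB₀, Finset.sum_singleton, Finset.Ico_self, Finset.prod_empty, one_mul, aDet_eq_alt]
    simp only [hA.colContent_eq le_rfl, fillSum, mul_one]
  | succ m ih =>
    rw [alt_xyPow_mul_fillSum, ← Finset.sum_product']
    rw [← Finset.sum_fiberwise_of_maps_to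
      (t := colSet d (colHeight d μ (j + 1)) (fun r => v (r, j)) ×ˢ
        (Finset.range (colHeight d μ (j + 1))).powerset)
      (g := fun B : RevBarredTableau d μ =>
        ((fun r => B.val (r, j + 1)), barSet d μ B.barred (j + 1)))]
    · refine Finset.sum_congr rfl fun x hx => ?_
      obtain ⟨D, S⟩ := x
      obtain ⟨hD, hS⟩ := Finset.mem_product.mp hx
      simp only at hD hS
      rw [Finset.mem_powerset] at hS
      have hext := h.extend hD hS
      have hIH := ih (j + 1) (by omega) hext
      have hfilt : ((Finset.univ.filter fun B : RevBarredTableau d μ =>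
            Agree (j + 1) v b B.val B.barred).filter fun B =>
              ((fun r => B.val (r, j + 1)), barSet d μ B.barred (j + 1)) = (D, S)) =
          Finset.univ.filter fun B : RevBarredTableau d μ => Agree (j + 1 + 1)
            (fun a => if a.2 = j + 1 then D a.1 else v a)
            (fun a => if a.2 = j + 1 then a.1 ∈ S else b a) B.val B.barred := by
        ext B
        simp only [Finset.mem_filter, Finset.mem_univ, true_and, Prod.mk.injEq]
        constructor
        · rintro ⟨hA, rfl, rfl⟩ ⟨r, c⟩ hc
          rcases Nat.lt_succ_iff_lt_or_eq.mp hc with hc | hc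
          · have : c ≠ j + 1 := ne_of_lt hc
            simpa [this] using hA (r, c) hc
          · simp only at hc
            subst hc
            simp only [if_true, barSet, Finset.mem_filter, Finset.mem_range, true_and]
            exact ⟨fun hb => ⟨(mem_cells_iff hμ).mp (B.barred_sub _ hb), hb⟩, fun hb => hb.2⟩
        · intro hA
          refine ⟨?_, ?_, ?_⟩
          · rintro ⟨r, c⟩ hc
            have : c ≠ j + 1 := ne_of_lt hc
            simpa [this] using hA (r, c) (Nat.lt_succ_of_lt hc)
          · funext r
            simpa using (hA (r, j + 1) (Nat.lt_succ_self _)).1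
          · ext r
            have := (hA (r, j + 1) (Nat.lt_succ_self _)).2
            simp only [if_true] at this
            simp only [barSet, Finset.mem_filter, Finset.mem_range, this]
            exact ⟨fun hb => hb.2, fun hb => ⟨Finset.mem_range.mp (hS hb), hb⟩⟩
      have hAg : Agree (j + 1) v b (fun a => if a.2 = j + 1 then D a.1 else v a)
          (fun a => if a.2 = j + 1 then a.1 ∈ S else b a) := by
        rintro ⟨r, c⟩ hc
        have : c ≠ j + 1 := ne_of_lt hc
        simp [this]
      have hcont : (fun i : Fin d => ζ i + colContent μ
            (fun a => if a.2 = j + 1 then D a.1 else v a)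
            (fun a => if a.2 = j + 1 then a.1 ∈ S else b a) (j + 1 + 1) ((i : ℕ) + 1)) =
          fun i : Fin d => ζ i + colContent μ v b (j + 1) ((i : ℕ) + 1) +
            ((Finset.range (colHeight d μ (j + 1)) \ S).filter
              fun r => D r = (i : ℕ) + 1).card := by
        funext i
        rw [colContent_succ hμ, hAg.colContent_eq le_rfl, add_assoc]
        congr 3
        ext r
        simp [and_assoc]
      have hwt : colWt μ ζ (fun a => if a.2 = j + 1 then D a.1 else v a)
            (fun a => if a.2 = j + 1 then a.1 ∈ S else b a) (j + 1) =
          barWt d (j + 1) (fun i => ζ i + colContent μ v b (j + 1) ((i : ℕ) + 1)) D S := by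
        have hbar : barSet d μ (fun a : ℕ × ℕ => if a.2 = j + 1 then a.1 ∈ S else b a) (j + 1) =
            S := by
          simp only [barSet, if_true]
          exact (Finset.filter_mem_eq_inter).trans (Finset.inter_eq_right.mpr hS)
        unfold colWt
        rw [hbar]
        simp only [if_true, hAg.colContent_eq le_rfl]
      rw [hfilt]
      rw [hcont] at hIH
      simp only [if_true] at hIH
      rw [← hIH, Finset.mul_sum, ← hwt]
      refine Finset.sum_congr rfl fun B hB => ?_
      rw [Finset.prod_eq_prod_Ico_succ_bot (by omega),
        (Finset.mem_filter.mp hB).2.colWt_eq (Nat.lt_succ_self _), mul_assoc]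
    · intro B hB
      have hA := (Finset.mem_filter.mp hB).2
      refine Finset.mem_product.mpr ⟨mem_colSet.mpr ⟨?_, fun r hr => ?_⟩,
        Finset.mem_powerset.mpr (Finset.filter_subset _ _)⟩
      · exact (B.isPartialTableau hμ (j + 2)).isCol (j + 1) (by omega)
      · rw [← (hA (r, j) (Nat.lt_succ_self _)).1]
        exact (B.isPartialTableau hμ (j + 2)).row j (by omega) r hr

theorem RevBarredTableau.countBefore_eq {d : ℕ} {μ : Fin d → ℕ} (hμ : IsPartitionVec μ)
    (B : RevBarredTableau d μ) {a : ℕ × ℕ} (ha : a ∈ cells d μ) :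
    B.countBefore a (B.val a) = colContent μ B.val B.barred a.2 (B.val a) := by
  unfold RevBarredTableau.countBefore colContent
  congr 1
  refine Finset.filter_congr fun q hq => ?_
  refine and_congr_right fun _ => and_congr_right fun hv => ⟨fun h => ?_, Or.inl⟩
  refine h.resolve_right fun h => ?_
  obtain ⟨r, c⟩ := a
  obtain ⟨r', c'⟩ := q
  obtain ⟨rfl, hr⟩ : c' = c ∧ r < r' := h
  have := ((B.isPartialTableau hμ (c' + 1)).isCol c' (Nat.lt_succ_self _)).lt hr
    ((mem_cells_iff hμ).mp hq)
  omega

theorem RevBarredTableau.cXi_eq {d : ℕ} {μ : Fin d → ℕ} (hμ : IsPartitionVec μ) (ζ : Fin d → ℕ)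
    {N : ℕ} (hN : ∀ a ∈ cells d μ, a.2 < N) (B : RevBarredTableau d μ) :
    B.cXi (fun i => ζ i + 1) = ∏ c ∈ Finset.range N, colWt μ ζ B.val B.barred c := by
  unfold RevBarredTableau.cXi
  rw [← Finset.prod_fiberwise_of_maps_to (t := Finset.range N) (g := Prod.snd)
    fun a ha => Finset.mem_range.mpr (hN a (Finset.mem_filter.mp ha).1)]
  refine Finset.prod_congr rfl fun c _ => ?_
  unfold colWt barWt
  refine Finset.prod_nbij' (fun a => a.1) (fun r => (r, c)) ?_ ?_ ?_ ?_ ?_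
  · rintro ⟨r, c'⟩ h
    simp only [Finset.mem_filter] at h
    obtain ⟨⟨h1, h2⟩, rfl⟩ := h
    exact Finset.mem_filter.mpr ⟨Finset.mem_range.mpr ((mem_cells_iff hμ).mp h1), h2⟩
  · intro r h
    obtain ⟨h1, h2⟩ := Finset.mem_filter.mp h
    exact Finset.mem_filter.mpr ⟨Finset.mem_filter.mpr
      ⟨(mem_cells_iff hμ).mpr (Finset.mem_range.mp h1), h2⟩, rfl⟩
  · rintro ⟨r, c'⟩ h
    exact Prod.ext rfl (Finset.mem_filter.mp h).2.symm
  · exact fun r _ => rfl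
  · rintro ⟨r, c'⟩ h
    simp only [Finset.mem_filter] at h
    obtain ⟨⟨h1, _⟩, rfl⟩ := h
    have hv := B.mem _ h1
    have hlt : B.val (r, c') - 1 < d := by omega
    have e : B.val (r, c') - 1 + 1 = B.val (r, c') := by omega
    simp only [RevBarredTableau.eIdx, RevBarredTableau.fIdx, B.countBefore_eq hμ h1,
      vecAt_eq _ hlt, e]
    congr 2
    push_cast
    ring

theorem RevBarredTableau.content_eq {d : ℕ} {μ : Fin d → ℕ} {N : ℕ}
    (hN : ∀ a ∈ cells d μ, a.2 < N) (B : RevBarredTableau d μ) (k : ℕ) :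
    B.content k = colContent μ B.val B.barred N k := by
  unfold RevBarredTableau.content colContent
  congr 1
  exact Finset.filter_congr fun a ha =>
    and_congr_right fun _ => (and_iff_left (hN a ha)).symm

/-! ### Column prefixes that are not partitions -/

/-- Adding to `lam` the content of the columns with index at most `j` does not give a
partition: it violates the inequality between the components `k` and `k + 1`. -/
def Violates {d : ℕ} (lam μ : Fin d → ℕ) (v : ℕ × ℕ → ℕ) (b : ℕ × ℕ → Prop) (j k : ℕ) : Prop :=
  1 ≤ k ∧ k + 1 ≤ d ∧
    vecAt lam k + colContent μ v b (j + 1) k < vecAt lam (k + 1) + colContent μ v b (j + 1) (k + 1)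

theorem Agree.violates_iff {d : ℕ} {lam μ : Fin d → ℕ} {j i k : ℕ} {v v' : ℕ × ℕ → ℕ}
    {b b' : ℕ × ℕ → Prop} (h : Agree (j + 1) v b v' b') (hi : i ≤ j) :
    Violates lam μ v' b' i k ↔ Violates lam μ v b i k := by
  unfold Violates
  rw [h.colContent_eq (by omega), h.colContent_eq (by omega)]

theorem vecAt_succ_le {d : ℕ} {lam : Fin d → ℕ} (hlam : IsPartitionVec lam) {k : ℕ}
    (hkd : k + 1 ≤ d) : vecAt lam (k + 1) ≤ vecAt lam k := by
  rw [vecAt_eq lam (show k + 1 - 1 < d by omega), vecAt_eq lam (show k - 1 < d by omega)]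
  exact hlam _ _ (by simp only [Fin.mk_le_mk]; omega)

/-- The first violation is caused by an unbarred `k + 1`, and it is as small as possible. -/
theorem Violates.exists_of_first {d : ℕ} {lam μ : Fin d → ℕ} (hlam : IsPartitionVec lam)
    (hμ : IsPartitionVec μ) {v : ℕ × ℕ → ℕ} {b : ℕ × ℕ → Prop} {j k : ℕ}
    (hcol : IsCol d (colHeight d μ j) fun r => v (r, j))
    (hv : Violates lam μ v b j k) (hmin : ∀ i < j, ¬ Violates lam μ v b i k) :
    (∃ r < colHeight d μ j, ¬ b (r, j) ∧ v (r, j) = k + 1) ∧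
      vecAt lam k + colContent μ v b (j + 1) k + 1 =
        vecAt lam (k + 1) + colContent μ v b (j + 1) (k + 1) := by
  obtain ⟨hk, hkd, hlt⟩ := hv
  have hprev : vecAt lam (k + 1) + colContent μ v b j (k + 1) ≤
      vecAt lam k + colContent μ v b j k := by
    cases j with
    | zero => simpa [colContent_zero] using vecAt_succ_le hlam hkd
    | succ i => exact not_lt.mp fun h => hmin i (Nat.lt_succ_self i) ⟨hk, hkd, h⟩
  rw [colContent_succ hμ, colContent_succ hμ _ _ _ (k + 1)] at *
  have hle : ((Finset.range (colHeight d μ j)).filter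
      fun r => ¬ b (r, j) ∧ v (r, j) = k + 1).card ≤ 1 := by
    refine Finset.card_le_one.mpr fun p hp q hq => ?_
    simp only [Finset.mem_filter, Finset.mem_range] at hp hq
    exact hcol.eq_of_eq hp.1 hq.1 (hp.2.2.trans hq.2.2.symm)
  have hpos : 0 < ((Finset.range (colHeight d μ j)).filter
      fun r => ¬ b (r, j) ∧ v (r, j) = k + 1).card := by omega
  obtain ⟨r, hr⟩ := Finset.card_pos.mp hpos
  simp only [Finset.mem_filter, Finset.mem_range] at hr
  exact ⟨⟨r, hr.1, hr.2⟩, by omega⟩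

theorem RevBarredTableau.not_starYam_of_violates {d : ℕ} {lam μ : Fin d → ℕ}
    (hlam : IsPartitionVec lam) (hμ : IsPartitionVec μ) (B : RevBarredTableau d μ) {j k : ℕ}
    (hv : Violates lam μ B.val B.barred j k) : ¬ B.StarYam lam := by
  induction j using Nat.strong_induction_on with
  | _ j ih =>
    by_cases hmin : ∃ i < j, Violates lam μ B.val B.barred i k
    · obtain ⟨i, hi, hvi⟩ := hmin
      exact ih i hi hvi
    · have hcol := (B.isPartialTableau hμ (j + 1)).isCol j (Nat.lt_succ_self _)
      obtain ⟨⟨r, hr, hb, hval⟩, -⟩ := hv.exists_of_first hlam hμ hcol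
        fun i hi h => hmin ⟨i, hi, h⟩
      intro hY
      have h1 := hY (r, j) ((mem_cells_iff hμ).mpr hr) hb k hv.1
      have h2 : colContent μ B.val B.barred (j + 1) (k + 1) ≤ B.countUpTo (r, j) (k + 1) := by
        refine Finset.card_le_card fun q hq => ?_
        obtain ⟨r', c⟩ := q
        simp only [Finset.mem_filter] at hq ⊢
        obtain ⟨hq1, hq2, hq3, hq4⟩ := hq
        refine ⟨hq1, hq2, hq3, ?_⟩
        rcases Nat.lt_succ_iff_lt_or_eq.mp hq4 with h | rfl
        · exact Or.inl (Or.inl h)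
        · refine Or.inr (Prod.ext ?_ rfl)
          exact hcol.eq_of_eq ((mem_cells_iff hμ).mp hq1) hr (hq3.trans hval.symm)
      have h3 : B.countUpTo (r, j) k ≤ colContent μ B.val B.barred (j + 1) k := by
        refine Finset.card_le_card fun q hq => ?_
        simp only [Finset.mem_filter] at hq ⊢
        refine ⟨hq.1, hq.2.1, hq.2.2.1, ?_⟩
        rcases hq.2.2.2 with (h | h) | rfl
        · exact Nat.lt_succ_of_lt h
        · exact h.1 ▸ Nat.lt_succ_self _
        · exact Nat.lt_succ_self _
      have := hv.2.2
      omega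

theorem RevBarredTableau.exists_violates {d : ℕ} {lam μ : Fin d → ℕ}
    (hlam : IsPartitionVec lam) (hμ : IsPartitionVec μ) (B : RevBarredTableau d μ)
    (hB : ¬ B.StarYam lam) :
    ∃ j k, Violates lam μ B.val B.barred j k ∧ ∃ a ∈ cells d μ, j ≤ a.2 := by
  unfold RevBarredTableau.StarYam at hB
  push Not at hB
  obtain ⟨⟨r, c⟩, ha, hb, k, hk, hlt⟩ := hB
  have hkd : k + 1 ≤ d := by
    by_contra hn
    have h0 : vecAt lam (k + 1) = 0 := dif_neg (by omega)
    have h1 : B.countUpTo (r, c) (k + 1) = 0 := by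
      refine Finset.card_eq_zero.mpr (Finset.filter_eq_empty_iff.mpr fun q hq h => ?_)
      have := (B.mem q hq).2
      omega
    omega
  have hcol := (B.isPartialTableau hμ (c + 1)).isCol c (Nat.lt_succ_self _)
  by_cases hread : ∃ q, (q, c) ∈ cells d μ ∧ B.val (q, c) = k + 1 ∧ r ≤ q
  · refine ⟨c, k, ⟨hk, hkd, lt_of_le_of_lt ?_ (lt_of_lt_of_le hlt ?_)⟩, _, ha, le_rfl⟩
    · refine Nat.add_le_add_left (Finset.card_le_card fun p hp => ?_) _
      obtain ⟨q, hq, hqv, hrq⟩ := hread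
      obtain ⟨r', c'⟩ := p
      simp only [Finset.mem_filter] at hp ⊢
      obtain ⟨hp1, hp2, hp3, hp4⟩ := hp
      refine ⟨hp1, hp2, hp3, Or.inl ?_⟩
      rcases Nat.lt_succ_iff_lt_or_eq.mp hp4 with h | rfl
      · exact Or.inl h
      · refine Or.inr ⟨rfl, lt_of_le_of_lt hrq ?_⟩
        change q < r'
        by_contra hn
        rcases (not_lt.mp hn).eq_or_lt with rfl | hl
        · omega
        · have := hcol.lt hl ((mem_cells_iff hμ).mp hq)
          omega
    · refine Nat.add_le_add_left (Finset.card_le_card fun p hp => ?_) _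
      simp only [Finset.mem_filter] at hp ⊢
      refine ⟨hp.1, hp.2.1, hp.2.2.1, ?_⟩
      rcases hp.2.2.2 with (h | h) | rfl
      · exact Nat.lt_succ_of_lt h
      · exact h.1 ▸ Nat.lt_succ_self _
      · exact Nat.lt_succ_self _
  · have h1 : B.countUpTo (r, c) (k + 1) ≤ colContent μ B.val B.barred c (k + 1) := by
      refine Finset.card_le_card fun p hp => ?_
      obtain ⟨r', c'⟩ := p
      simp only [Finset.mem_filter] at hp ⊢
      refine ⟨hp.1, hp.2.1, hp.2.2.1, ?_⟩
      rcases hp.2.2.2 with (h | h) | h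
      · exact h
      · obtain ⟨rfl, hr⟩ : c' = c ∧ r < r' := h
        exact absurd ⟨r', hp.1, hp.2.2.1, hr.le⟩ hread
      · obtain ⟨rfl, rfl⟩ := Prod.mk.inj h
        exact absurd ⟨r', hp.1, hp.2.2.1, le_rfl⟩ hread
    have h2 : colContent μ B.val B.barred c k ≤ B.countUpTo (r, c) k := by
      refine Finset.card_le_card fun p hp => ?_
      simp only [Finset.mem_filter] at hp ⊢
      exact ⟨hp.1, hp.2.1, hp.2.2.1, Or.inl (Or.inl hp.2.2.2)⟩
    cases c with
    | zero =>
      rw [colContent_zero] at h1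
      have := vecAt_succ_le hlam hkd
      omega
    | succ c => exact ⟨c, k, ⟨hk, hkd, by omega⟩, _, ha, Nat.le_succ c⟩

/-- The tableaux sharing with `v`, `b` the columns up to the first violation cancel. -/
theorem sum_agree_eq_zero {d : ℕ} {lam μ : Fin d → ℕ} (hlam : IsPartitionVec lam)
    (hμ : IsPartitionVec μ) {N : ℕ} (hN : ∀ a ∈ cells d μ, a.2 < N) {v : ℕ × ℕ → ℕ}
    {b : ℕ × ℕ → Prop} {j k : ℕ} (hj : j < N) (h : IsPartialTableau μ (j + 1) v b)
    (hv : Violates lam μ v b j k) (hmin : ∀ i < j, ¬ Violates lam μ v b i k) :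
    ∑ B : RevBarredTableau d μ with Agree (j + 1) v b B.val B.barred,
        B.cXi (fun i => lam i + rho d i + 1) *
          aDet d (fun i => lam i + rho d i + B.content ((i : ℕ) + 1)) = 0 := by
  have hcol := h.isCol j (Nat.lt_succ_self _)
  obtain ⟨⟨r, -, -, hval⟩, heq⟩ := hv.exists_of_first hlam hμ hcol hmin
  obtain ⟨hk, hkd, -⟩ := hv
  have hzero := sum_agree_eq_alt hμ (fun i => lam i + rho d i) hN (N - (j + 1)) j (by omega) h
  rw [alt_xyPow_mul_fillSum_eq_zero hk hkd (colHeight d μ) _ j hcol hval] at hzero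
  · rw [← mul_zero (∏ c ∈ Finset.range (j + 1), colWt μ (fun i => lam i + rho d i) v b c),
      ← hzero, Finset.mul_sum]
    refine Finset.sum_congr rfl fun B hB => ?_
    have hA := (Finset.mem_filter.mp hB).2
    rw [B.cXi_eq hμ (fun i => lam i + rho d i) hN,
      ← Finset.prod_range_mul_prod_Ico _ (show j + 1 ≤ N by omega), mul_assoc,
      Finset.prod_congr rfl fun c hc => (hA.colWt_eq (Finset.mem_range.mp hc)).symm]
    simp only [B.content_eq hN]
  · have e : k - 1 + 1 = k := by omega
    rw [vecAt_eq lam (show k - 1 < d by omega), vecAt_eq lam (show k + 1 - 1 < d by omega)] at heq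
    simp only [rho, e]
    simp only [Nat.add_sub_cancel] at heq
    omega

/-- The index of the first column at which a column prefix is not a partition. -/
def firstViolation {d : ℕ} {μ : Fin d → ℕ} (lam : Fin d → ℕ) (B : RevBarredTableau d μ) : ℕ :=
  sInf {j | ∃ k, Violates lam μ B.val B.barred j k}

theorem firstViolation_eq_of_agree {d : ℕ} {lam μ : Fin d → ℕ} {B B' : RevBarredTableau d μ}
    {k : ℕ} (hv : Violates lam μ B.val B.barred (firstViolation lam B) k)
    (h : Agree (firstViolation lam B + 1) B.val B.barred B'.val B'.barred) :
    firstViolation lam B' = firstViolation lam B := by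
  have hv' : Violates lam μ B'.val B'.barred (firstViolation lam B) k :=
    (h.violates_iff le_rfl).mpr hv
  refine le_antisymm (Nat.sInf_le ⟨k, hv'⟩) (not_lt.mp fun hlt => ?_)
  have hne : {j | ∃ k, Violates lam μ B'.val B'.barred j k}.Nonempty := ⟨_, k, hv'⟩
  obtain ⟨k', hk'⟩ := Nat.sInf_mem hne
  exact Nat.notMem_of_lt_sInf hlt ⟨k', (h.violates_iff hlt.le).mp hk'⟩

/-- Two tableaux are related when they first violate at the same column and agree up to it. -/
def violationSetoid {d : ℕ} (lam μ : Fin d → ℕ) : Setoid (RevBarredTableau d μ) where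
  r B B' := firstViolation lam B = firstViolation lam B' ∧
    Agree (firstViolation lam B + 1) B.val B.barred B'.val B'.barred
  iseqv :=
    { refl := fun _ => ⟨rfl, fun _ _ => ⟨rfl, Iff.rfl⟩⟩
      symm := fun ⟨h1, h2⟩ =>
        ⟨h1.symm, fun a ha => ⟨(h2 a (h1 ▸ ha)).1.symm, (h2 a (h1 ▸ ha)).2.symm⟩⟩
      trans := fun ⟨h1, h2⟩ ⟨h3, h4⟩ => ⟨h1.trans h3, fun a ha =>
        ⟨(h4 a (h1 ▸ ha)).1.trans (h2 a ha).1, (h4 a (h1 ▸ ha)).2.trans (h2 a ha).2⟩⟩ }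

/-- Cancellation lemma: `Σ c_{λ*B} · a_{λ+ρ+ω(B^u)}(x|y) = 0`, summed
over all reverse barred tableaux `B` of shape `μ` such that the unbarred column word of
`λ*B` is *not* Yamanouchi. -/
theorem cancellation_lemma (d : ℕ) (hd : 1 ≤ d)
    (lam mu : Fin d → ℕ) (hlam : IsPartitionVec lam) (hmu : IsPartitionVec mu) :
    ∑ᶠ B ∈ {B : RevBarredTableau d mu | ¬ B.StarYam lam},
        B.cXi (fun i => lam i + rho d i + 1) *
          aDet d (fun i => lam i + rho d i + B.content ((i : ℕ) + 1)) = 0 := by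
  rw [finsum_mem_eq_toFinset_sum]
  refine Finset.sum_cancels_of_partition_cancels (violationSetoid lam mu) fun B hB => ?_
  have hB : ¬ B.StarYam lam := by simpa using hB
  obtain ⟨j₀, k₀, hv₀, a, ha, hja⟩ := B.exists_violates hlam hmu hB
  have hN : ∀ a ∈ cells d mu, a.2 < Finset.univ.sup mu + 1 := fun a ha =>
    Finset.mem_range.mp (Finset.mem_product.mp (Finset.mem_filter.mp ha).1).2
  have hle : firstViolation lam B ≤ j₀ := Nat.sInf_le ⟨k₀, hv₀⟩
  have hne : {j | ∃ k, Violates lam mu B.val B.barred j k}.Nonempty := ⟨j₀, k₀, hv₀⟩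
  obtain ⟨k, hv⟩ : ∃ k, Violates lam mu B.val B.barred (firstViolation lam B) k :=
    Nat.sInf_mem hne
  rw [← sum_agree_eq_zero hlam hmu hN ((hle.trans hja).trans_lt (hN a ha))
    (B.isPartialTableau hmu _) hv fun i hi h => Nat.notMem_of_lt_sInf hi ⟨k, h⟩]
  refine Finset.sum_congr ?_ fun _ _ => rfl
  ext B'
  simp only [Finset.mem_filter, Set.mem_toFinset, Set.mem_ofPred_eq, Finset.mem_univ, true_and]
  constructor
  · rintro ⟨-, h⟩
    exact ((violationSetoid lam mu).symm h).2
  · intro h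
    have e := firstViolation_eq_of_agree hv h
    have hv' : Violates lam mu B'.val B'.barred (firstViolation lam B) k :=
      (h.violates_iff le_rfl).mpr hv
    refine ⟨B'.not_starYam_of_violates hlam hmu hv', ?_⟩
    exact (violationSetoid lam mu).symm ⟨e.symm, h⟩

end EqLR
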